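/- Q-function perturbation under ε-greedy exploration (intermediate claim in the proof of Theorem 1). Let π be a policy, ε ∈ [0,1], and define the behavior policy π̂(a|s) = ε/|A| + (1−ε)·π(a|s). Then for every i = 0,…,N, ‖Q_i^{π̂} − Q_i^{π}‖ ≤ 2·|S|^{3/2}·|A|·ε / (1−γ)². -/

import Mathlib

open Finset

/-- `π` is a (Markov, stationary) policy: a probability distribution over actions per state. -/
def IsPolicy {S A : Type*} [Fintype A] (π : S → A → ℝ) : Prop :=
  (∀ s a, 0 ≤ π s a) ∧ ∀ s, ∑ a, π s a = 1

/-- `P` is a transition kernel. -/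
def IsKernel {S A : Type*} [Fintype S] (P : S → A → S → ℝ) : Prop :=
  (∀ s a s', 0 ≤ P s a s') ∧ ∀ s a, ∑ s', P s a s' = 1

/-- `ρ` is a probability distribution on `S`. -/
def IsDist {S : Type*} [Fintype S] (ρ : S → ℝ) : Prop :=
  (∀ s, 0 ≤ ρ s) ∧ ∑ s, ρ s = 1

/-- `Q` solves the Bellman equation `Q = r + γ P^π Q` for reward `r`, kernel `P`,
discount `γ` and policy `π` (for `γ ∈ (0,1)` the solution exists and is unique). -/
def IsBellman {S A : Type*} [Fintype S] [Fintype A]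
    (P : S → A → S → ℝ) (γ : ℝ) (r : S → A → ℝ) (π : S → A → ℝ)
    (Q : S → A → ℝ) : Prop :=
  ∀ s a, Q s a = r s a + γ * ∑ s', P s a s' * ∑ a', π s' a' * Q s' a'

/-- The value `V^π(ρ) = ∑_s ρ(s) ∑_a π(a|s) Q(s,a)` computed from a `Q`-table. -/
def Vval {S A : Type*} [Fintype S] [Fintype A]
    (ρ : S → ℝ) (π : S → A → ℝ) (Q : S → A → ℝ) : ℝ :=
  ∑ s, ρ s * ∑ a, π s a * Q s a

/-- Advantage computed from a `Q`-table: `A(s,a) = Q(s,a) − ∑_{a'} π(a'|s) Q(s,a')`. -/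
def adv {S A : Type*} [Fintype A] (π : S → A → ℝ) (Q : S → A → ℝ)
    (s : S) (a : A) : ℝ :=
  Q s a - ∑ a', π s a' * Q s a'

/-- Euclidean norm of a table on `S × A` viewed as a vector in `ℝ^{|S||A|}`. -/
noncomputable def tnorm {S A : Type*} [Fintype S] [Fintype A] (f : S → A → ℝ) : ℝ :=
  Real.sqrt (∑ s, ∑ a, (f s a) ^ 2)

/-- Sup norm of a table on `S × A`. -/
noncomputable def supnorm {S A : Type*} [Fintype S] [Fintype A] (f : S → A → ℝ) : ℝ :=
  ⨆ p : S × A, |f p.1 p.2|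

/-- An average of an average of values bounded by `M` is bounded by `M`. -/
lemma IsKernel.sum_mul_policy_le {S A : Type*} [Fintype S] [Fintype A]
    {P : S → A → S → ℝ} (hP : IsKernel P) {π : S → A → ℝ} (hπ : IsPolicy π)
    {f : S → A → ℝ} {M : ℝ} (hf : ∀ s a, f s a ≤ M) (s : S) (a : A) :
    ∑ s', P s a s' * ∑ a', π s' a' * f s' a' ≤ M := by
  have inner (s' : S) : ∑ a', π s' a' * f s' a' ≤ M := by
    calc ∑ a', π s' a' * f s' a' ≤ ∑ a', π s' a' * M :=
          sum_le_sum fun a' _ => mul_le_mul_of_nonneg_left (hf s' a') (hπ.1 s' a')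
      _ = M := by rw [← sum_mul, hπ.2, one_mul]
  calc ∑ s', P s a s' * ∑ a', π s' a' * f s' a' ≤ ∑ s', P s a s' * M :=
        sum_le_sum fun s' _ => mul_le_mul_of_nonneg_left (inner s') (hP.1 s a s')
    _ = M := by rw [← sum_mul, hP.2, one_mul]

/-- Maximum principle for the Bellman operator: a subsolution with reward at most `c`
is bounded by `c / (1 - γ)`. -/
lemma le_div_of_bellman_subsolution {S A : Type*} [Fintype S] [Fintype A]
    {P : S → A → S → ℝ} (hP : IsKernel P) {π : S → A → ℝ} (hπ : IsPolicy π)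
    {γ : ℝ} (hγ : γ ∈ Set.Ioo (0 : ℝ) 1) {f : S → A → ℝ} {c : ℝ}
    (hf : ∀ s a, f s a ≤ c + γ * ∑ s', P s a s' * ∑ a', π s' a' * f s' a')
    (s : S) (a : A) : f s a ≤ c / (1 - γ) := by
  have : Nonempty (S × A) := ⟨(s, a)⟩
  obtain ⟨p, hp⟩ := Finite.exists_max fun p : S × A => f p.1 p.2
  have hmax := hP.sum_mul_policy_le hπ (fun s a => hp (s, a)) p.1 p.2
  refine (hp (s, a)).trans ?_
  rw [le_div_iff₀ (sub_pos.2 hγ.2)]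
  have := hf p.1 p.2
  have := mul_le_mul_of_nonneg_left hmax hγ.1.le
  dsimp only at *
  linarith

/-- Mixing a policy with the uniform distribution gives a policy. -/
lemma IsPolicy.mix_uniform {S A : Type*} [Fintype A] [Nonempty A]
    {π : S → A → ℝ} (hπ : IsPolicy π) {ε : ℝ} (hε : ε ∈ Set.Icc (0 : ℝ) 1) :
    IsPolicy fun s a => ε / (Fintype.card A : ℝ) + (1 - ε) * π s a := by
  refine ⟨fun s a => ?_, fun s => ?_⟩
  · have := mul_nonneg (sub_nonneg.2 hε.2) (hπ.1 s a)
    have := div_nonneg hε.1 (Nat.cast_nonneg (α := ℝ) (Fintype.card A))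
    linarith
  · rw [sum_add_distrib, ← mul_sum, hπ.2, sum_const, card_univ, nsmul_eq_mul]
    have : (Fintype.card A : ℝ) ≠ 0 := Nat.cast_ne_zero.2 Fintype.card_ne_zero
    field_simp
    ring

/-- Averages of a `[0, M]`-valued table under a policy lie in `[0, M]`. -/
lemma IsPolicy.sum_mul_mem_Icc {S A : Type*} [Fintype A] {π : S → A → ℝ} (hπ : IsPolicy π)
    {q : A → ℝ} {M : ℝ} (hq : ∀ a, q a ∈ Set.Icc 0 M) (s : S) :
    ∑ a, π s a * q a ∈ Set.Icc 0 M := by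
  refine ⟨sum_nonneg fun a _ => mul_nonneg (hπ.1 s a) (hq a).1, ?_⟩
  calc ∑ a, π s a * q a ≤ ∑ a, π s a * M :=
        sum_le_sum fun a _ => mul_le_mul_of_nonneg_left (hq a).2 (hπ.1 s a)
    _ = M := by rw [← sum_mul, hπ.2, one_mul]

/-- Mixing with the uniform distribution moves averages of a `[0, M]`-valued function
by at most `ε * M`. -/
lemma IsPolicy.abs_sum_mix_uniform_sub_le {S A : Type*} [Fintype A] [Nonempty A]
    {π : S → A → ℝ} (hπ : IsPolicy π) {ε : ℝ} (hε : ε ∈ Set.Icc (0 : ℝ) 1)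
    {q : A → ℝ} {M : ℝ} (hq : ∀ a, q a ∈ Set.Icc 0 M) (s : S) :
    |∑ a, (ε / (Fintype.card A : ℝ) + (1 - ε) * π s a) * q a - ∑ a, π s a * q a| ≤ ε * M := by
  have hu := (hπ.mix_uniform (ε := 1) ⟨zero_le_one, le_rfl⟩).sum_mul_mem_Icc hq s
  have hp := hπ.sum_mul_mem_Icc hq s
  simp only [sub_self, zero_mul, add_zero] at hu
  have key : ∑ a, (ε / (Fintype.card A : ℝ) + (1 - ε) * π s a) * q a - ∑ a, π s a * q a
      = ε * (∑ a, 1 / (Fintype.card A : ℝ) * q a - ∑ a, π s a * q a) := by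
    rw [← sum_sub_distrib, ← sum_sub_distrib, mul_sum]
    exact sum_congr rfl fun a _ => by ring
  rw [key, abs_mul, abs_of_nonneg hε.1]
  refine mul_le_mul_of_nonneg_left ?_ hε.1
  rw [abs_le]
  constructor <;> linarith [hu.1, hu.2, hp.1, hp.2]

/-- The `Q`-function of a `[0, 1]`-valued reward lies in `[0, 1 / (1 - γ)]`. -/
lemma IsBellman.mem_Icc {S A : Type*} [Fintype S] [Fintype A]
    {P : S → A → S → ℝ} (hP : IsKernel P) {π : S → A → ℝ} (hπ : IsPolicy π)
    {γ : ℝ} (hγ : γ ∈ Set.Ioo (0 : ℝ) 1) {r Q : S → A → ℝ}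
    (hr : ∀ s a, r s a ∈ Set.Icc (0 : ℝ) 1) (hQ : IsBellman P γ r π Q) (s : S) (a : A) :
    Q s a ∈ Set.Icc 0 (1 / (1 - γ)) := by
  constructor
  · have := le_div_of_bellman_subsolution hP hπ hγ (f := fun s a => -Q s a) (c := 0)
      (fun s a => by
        simp only [mul_neg, sum_neg_distrib]
        linarith [hQ s a, (hr s a).1]) s a
    rw [zero_div] at this
    linarith
  · exact le_div_of_bellman_subsolution hP hπ hγ
      (fun s a => by linarith [hQ s a, (hr s a).2]) s a

/-- Two solutions of Bellman equations with the same reward differ by at most `δ / (1 - γ)`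
when the averages of the second one under the two policies differ by at most `δ`. -/
lemma IsBellman.sub_le {S A : Type*} [Fintype S] [Fintype A]
    {P : S → A → S → ℝ} (hP : IsKernel P) {π π' : S → A → ℝ} (hπ' : IsPolicy π')
    {γ : ℝ} (hγ : γ ∈ Set.Ioo (0 : ℝ) 1) {r Q Q' : S → A → ℝ}
    (hQ : IsBellman P γ r π Q) (hQ' : IsBellman P γ r π' Q') {δ : ℝ}
    (hδ : ∀ s, |∑ a, π' s a * Q s a - ∑ a, π s a * Q s a| ≤ δ) (s : S) (a : A) :
    |Q' s a - Q s a| ≤ δ / (1 - γ) := by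
  have hδ0 : 0 ≤ δ := (abs_nonneg _).trans (hδ s)
  have split (s : S) (a : A) : Q' s a - Q s a
      = γ * ∑ s', P s a s' * (∑ a', π' s' a' * Q s' a' - ∑ a', π s' a' * Q s' a')
        + γ * ∑ s', P s a s' * ∑ a', π' s' a' * (Q' s' a' - Q s' a') := by
    rw [hQ s a, hQ' s a]
    simp only [mul_sub, sum_sub_distrib]
    ring
  have small (s : S) (a : A) :
      |γ * ∑ s', P s a s' * (∑ a', π' s' a' * Q s' a' - ∑ a', π s' a' * Q s' a')| ≤ δ := by
    have : |∑ s', P s a s' * (∑ a', π' s' a' * Q s' a' - ∑ a', π s' a' * Q s' a')| ≤ δ := by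
      calc _ ≤ ∑ s', |P s a s' * (∑ a', π' s' a' * Q s' a' - ∑ a', π s' a' * Q s' a')| :=
            abs_sum_le_sum_abs _ _
        _ ≤ ∑ s', P s a s' * δ := sum_le_sum fun s' _ => by
            rw [abs_mul, abs_of_nonneg (hP.1 s a s')]
            exact mul_le_mul_of_nonneg_left (hδ s') (hP.1 s a s')
        _ = δ := by rw [← sum_mul, hP.2, one_mul]
    rw [abs_mul, abs_of_pos hγ.1]
    exact (mul_le_of_le_one_left (abs_nonneg _) hγ.2.le).trans this
  rw [abs_le']
  constructor
  · exact le_div_of_bellman_subsolution hP hπ' hγ (f := fun s a => Q' s a - Q s a)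
      (fun s a => by linarith [split s a, (abs_le.1 (small s a)).2]) s a
  · refine le_div_of_bellman_subsolution hP hπ' hγ (f := fun s a => -(Q' s a - Q s a))
      (fun s a => ?_) s a
    have := split s a
    have := (abs_le.1 (small s a)).1
    simp only [mul_neg, sum_neg_distrib]
    linarith

/-- The Euclidean norm of a table is at most the number of entries times a uniform bound. -/
lemma tnorm_le_card_mul {S A : Type*} [Fintype S] [Fintype A] [Nonempty S] [Nonempty A]
    {f : S → A → ℝ} {B : ℝ} (hB : 0 ≤ B) (hf : ∀ s a, |f s a| ≤ B) :
    tnorm f ≤ (Fintype.card S : ℝ) * (Fintype.card A : ℝ) * B := by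
  have hS : (1 : ℝ) ≤ Fintype.card S := Nat.one_le_cast.2 Fintype.card_pos
  have hA : (1 : ℝ) ≤ Fintype.card A := Nat.one_le_cast.2 Fintype.card_pos
  have hSA : (1 : ℝ) ≤ (Fintype.card S : ℝ) * Fintype.card A := one_le_mul_of_one_le_of_one_le hS hA
  refine Real.sqrt_le_iff.2 ⟨by positivity, ?_⟩
  calc ∑ s, ∑ a, f s a ^ 2 ≤ ∑ _s : S, ∑ _a : A, B ^ 2 :=
        sum_le_sum fun s _ => sum_le_sum fun a _ => sq_le_sq.2 <| by
          rw [abs_of_nonneg hB]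
          exact hf s a
    _ = (Fintype.card S : ℝ) * Fintype.card A * B ^ 2 := by
        simp only [sum_const, card_univ, nsmul_eq_mul]
        ring
    _ ≤ ((Fintype.card S : ℝ) * Fintype.card A) ^ 2 * B ^ 2 :=
        mul_le_mul_of_nonneg_right (le_self_pow₀ hSA two_ne_zero) (sq_nonneg B)
    _ = _ := by ring

/-- Q-function perturbation under ε-greedy exploration. -/
theorem q_perturbation_eps_greedy
    {S A : Type*} [Fintype S] [Fintype A] [Nonempty S] [Nonempty A]
    (N : ℕ) (hN : 1 ≤ N)
    (P : S → A → S → ℝ) (hP : IsKernel P)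
    (γ : ℝ) (hγ : γ ∈ Set.Ioo (0:ℝ) 1)
    (r : Fin (N+1) → S → A → ℝ) (hr : ∀ i s a, r i s a ∈ Set.Icc (0:ℝ) 1)
    (π : S → A → ℝ) (hπ : IsPolicy π)
    (ε : ℝ) (hε : ε ∈ Set.Icc (0:ℝ) 1)
    (πh : S → A → ℝ)
    (hπh : ∀ s a, πh s a = ε / (Fintype.card A : ℝ) + (1-ε) * π s a)
    (Qπ Qπh : Fin (N+1) → S → A → ℝ)
    (hQπ : ∀ i, IsBellman P γ (r i) π (Qπ i))
    (hQπh : ∀ i, IsBellman P γ (r i) πh (Qπh i)) :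
    ∀ i, tnorm (fun s a => Qπh i s a - Qπ i s a)
      ≤ 2 * (Fintype.card S : ℝ) ^ ((3:ℝ)/2) * (Fintype.card A : ℝ) * ε / (1-γ)^2 := by
  intro i
  obtain rfl : πh = fun s a => ε / (Fintype.card A : ℝ) + (1 - ε) * π s a :=
    funext fun s => funext fun a => hπh s a
  have hγ1 : 0 < 1 - γ := sub_pos.2 hγ.2
  have hε0 : 0 ≤ ε := hε.1
  have hQ := (hQπ i).mem_Icc hP hπ hγ (hr i)
  have hdiff := (hQπ i).sub_le hP (hπ.mix_uniform hε) hγ (hQπh i)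
    fun s => hπ.abs_sum_mix_uniform_sub_le hε (hQ s) s
  refine (tnorm_le_card_mul (by positivity) hdiff).trans ?_
  have hS : (Fintype.card S : ℝ) ≤ 2 * (Fintype.card S : ℝ) ^ ((3 : ℝ) / 2) := by
    have h := Real.self_le_rpow_of_one_le (x := (Fintype.card S : ℝ)) (y := (3 : ℝ) / 2)
      (Nat.one_le_cast.2 Fintype.card_pos) (by norm_num)
    have : (0 : ℝ) ≤ Fintype.card S := Nat.cast_nonneg _
    linarith
  calc (Fintype.card S : ℝ) * (Fintype.card A : ℝ) * (ε * (1 / (1 - γ)) / (1 - γ))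
      = (Fintype.card S : ℝ) * ((Fintype.card A : ℝ) * ε / (1 - γ) ^ 2) := by field_simp
    _ ≤ 2 * (Fintype.card S : ℝ) ^ ((3 : ℝ) / 2) * ((Fintype.card A : ℝ) * ε / (1 - γ) ^ 2) :=
        mul_le_mul_of_nonneg_right hS (by positivity)
    _ = _ := by ring
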